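/- arXiv:1408.5650 — 2 statements merged into one kernel-verified Lean document; each statement's English description precedes it below -/
import Mathlib

section
/- For any lattice Λ in ℂ, the discriminant Δ(Λ) = g₂(Λ)³ − 27 g₃(Λ)² is nonzero. -/
/-- The point `m ω₁ + n ω₂` of the lattice `ℤω₁ + ℤω₂`. -/
noncomputable def latticePt (om1 om2 : ℂ) (p : ℤ × ℤ) : ℂ := p.1 * om1 + p.2 * om2

/-- `g₂(Λ) = 60 ∑_{λ ∈ Λ \\ {0}} λ⁻⁴`. -/
noncomputable def g2 (om1 om2 : ℂ) : ℂ :=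
  60 * ∑' p : {p : ℤ × ℤ // p ≠ 0}, 1 / latticePt om1 om2 p.1 ^ 4

/-- `g₃(Λ) = 140 ∑_{λ ∈ Λ \\ {0}} λ⁻⁶`. -/
noncomputable def g3 (om1 om2 : ℂ) : ℂ :=
  140 * ∑' p : {p : ℤ × ℤ // p ≠ 0}, 1 / latticePt om1 om2 p.1 ^ 6

/-- `Δ(Λ) = g₂(Λ)³ - 27 g₃(Λ)²`. -/
noncomputable def disc (om1 om2 : ℂ) : ℂ := g2 om1 om2 ^ 3 - 27 * g3 om1 om2 ^ 2

/-- The Weierstrass ℘-function relative to the lattice `ℤω₁ + ℤω₂`. -/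
noncomputable def wp (om1 om2 z : ℂ) : ℂ :=
  1 / z ^ 2 + ∑' p : {p : ℤ × ℤ // p ≠ 0},
    (1 / (z - latticePt om1 om2 p.1) ^ 2 - 1 / latticePt om1 om2 p.1 ^ 2)

open UpperHalfPlane EisensteinSeries in
lemma sum_latticePt_aux (om1 om2 : ℂ) (z : ℍ) (h2 : om2 ≠ 0) (hz : (z : ℂ) * om2 = om1)
    {k : ℕ} (hk : 3 ≤ k) :
    ∑' p : {p : ℤ × ℤ // p ≠ 0}, 1 / latticePt om1 om2 p.1 ^ k =
      (om2 ^ k)⁻¹ * (2 * riemannZeta k * ModularForm.E hk z) := by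
  have hE : ModularForm.E hk z = (1 / 2 : ℂ) * eisensteinSeries (N := 1) 0 k z := rfl
  have h1 : 2 * riemannZeta k * ModularForm.E hk z = ∑' v : Fin 2 → ℤ, eisSummand k v z := by
    rw [tsum_eisSummand_eq_riemannZeta_mul_eisensteinSeries hk z, hE]
    ring
  rw [h1, ← tsum_mul_left, ← (finTwoArrowEquiv ℤ).symm.tsum_eq]
  have h3 := tsum_subtype {p : ℤ × ℤ | p ≠ 0} (fun p => 1 / latticePt om1 om2 p ^ k)
  refine h3.trans (tsum_congr fun p => ?_)
  by_cases hp : p = 0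
  · subst hp
    have : k ≠ 0 := by omega
    simp [eisSummand, this]
  · rw [Set.indicator_of_mem (by exact hp)]
    simp only [latticePt, eisSummand, finTwoArrowEquiv_symm_apply, zpow_neg, zpow_natCast,
      ← hz, one_div, ← mul_inv, ← mul_pow]
    simp
    ring

lemma sum_latticePt_swap (om1 om2 : ℂ) (k : ℕ) :
    ∑' p : {p : ℤ × ℤ // p ≠ 0}, 1 / latticePt om1 om2 p.1 ^ k =
      ∑' p : {p : ℤ × ℤ // p ≠ 0}, 1 / latticePt om2 om1 p.1 ^ k := by
  let e : {p : ℤ × ℤ // p ≠ 0} ≃ {p : ℤ × ℤ // p ≠ 0} :=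
    (Equiv.prodComm ℤ ℤ).subtypeEquiv (fun p => by
      simp [Prod.ext_iff, and_comm, not_and_or, or_comm])
  rw [← e.tsum_eq]
  refine tsum_congr fun p => ?_
  simp [e, latticePt, add_comm]

lemma disc_swap (om1 om2 : ℂ) : disc om1 om2 = disc om2 om1 := by
  simp only [disc, g2, g3, sum_latticePt_swap om1 om2]

lemma zeta_six : riemannZeta 6 = (Real.pi : ℂ) ^ 6 / 945 := by
  have h := riemannZeta_two_mul_nat (k := 3) (by norm_num)
  norm_num at h
  have hb : bernoulli 6 = 1 / 42 := by
    decide +kernel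
  rw [h, hb]
  norm_num [Nat.factorial]
  ring

open UpperHalfPlane in
lemma disc_ne_zero_aux (om1 om2 : ℂ) (h2 : om2 ≠ 0) (him : 0 < (om1 / om2).im) :
    disc om1 om2 ≠ 0 := by
  let z : ℍ := ⟨om1 / om2, him⟩
  have hz : (z : ℂ) * om2 = om1 := div_mul_cancel₀ _ h2
  have h4 := sum_latticePt_aux om1 om2 z h2 hz (k := 4) (by norm_num)
  have h6 := sum_latticePt_aux om1 om2 z h2 hz (k := 6) (by norm_num)
  have hD := ModularForm.discriminant_eq_E₄_cube_sub_E₆_sq z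
  have hD0 := ModularForm.discriminant_ne_zero z
  have key : disc om1 om2 =
      4096 * (Real.pi : ℂ) ^ 12 * (om2 ^ 12)⁻¹ * ModularForm.discriminant z := by
    rw [hD, disc, g2, g3, h4, h6]
    push_cast
    rw [riemannZeta_four, zeta_six]
    field_simp
    ring
  rw [key]
  have : (Real.pi : ℂ) ≠ 0 := by exact_mod_cast Real.pi_ne_zero
  exact mul_ne_zero (mul_ne_zero (mul_ne_zero (by norm_num) (pow_ne_zero _ this))
    (inv_ne_zero (pow_ne_zero _ h2))) hD0

/-- For any lattice Λ in ℂ, the discriminant Δ(Λ) = g₂(Λ)³ − 27 g₃(Λ)² is nonzero. -/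
theorem disc_ne_zero (om1 om2 : ℂ) (h : LinearIndependent ℝ ![om1, om2]) :
    disc om1 om2 ≠ 0 := by
  have h1 : om1 ≠ 0 := h.ne_zero 0
  have h2 : om2 ≠ 0 := h.ne_zero 1
  have him : (om1 / om2).im ≠ 0 := by
    intro h0
    rw [LinearIndependent.pair_iff] at h
    have hr : ((om1 / om2).re : ℂ) = om1 / om2 := Complex.ext (by simp) (by simp [h0])
    have := h 1 (-(om1 / om2).re) (by
      rw [Complex.real_smul, Complex.real_smul, Complex.ofReal_neg, hr]
      field_simp
      simp)
    simp at this
  rcases lt_or_gt_of_ne him with hlt | hgt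
  · rw [disc_swap]
    refine disc_ne_zero_aux om2 om1 h1 ?_
    rw [← inv_div, Complex.inv_im]
    exact div_pos (by linarith) (Complex.normSq_pos.2 (div_ne_zero h1 h2))
  · exact disc_ne_zero_aux om1 om2 h2 hgt
end

section
/- The Weierstrass ℘-function satisfies the differential equation ℘'(z;Λ)² = 4℘(z;Λ)³ − g₂(Λ)℘(z;Λ) − g₃(Λ) for all z ∈ ℂ \ Λ. -/
/-- Transport of a sum over the lattice to a sum over pairs, removing a zero term. -/
lemma tsum_lattice_eq (L : PeriodPair) (f : ℂ → ℂ) (hf : f 0 = 0) :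
    ∑' l : L.lattice, f l = ∑' p : {p : ℤ × ℤ // p ≠ 0}, f (latticePt L.ω₁ L.ω₂ p.1) := by
  have h1 : ∑' l : L.lattice, f l = ∑' p : ℤ × ℤ, f (latticePt L.ω₁ L.ω₂ p) := by
    rw [← L.latticeEquivProd.symm.toEquiv.tsum_eq]
    refine tsum_congr fun p => ?_
    exact congrArg f (L.latticeEquiv_symm_apply p)
  rw [h1]
  symm
  refine tsum_subtype_eq_of_support_subset (s := {p : ℤ × ℤ | p ≠ 0})
    (f := fun p => f (latticePt L.ω₁ L.ω₂ p)) ?_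
  rintro p hp rfl
  exact hp (by simp [latticePt, hf])

/-- The Weierstrass differential equation:
℘\'(z;Λ)² = 4℘(z;Λ)³ − g₂(Λ)℘(z;Λ) − g₃(Λ) for z ∈ ℂ \\ Λ. -/
theorem wp_diff_eq (om1 om2 : ℂ) (h : LinearIndependent ℝ ![om1, om2]) (z : ℂ)
    (hz : z ∉ Set.range (latticePt om1 om2)) :
    (deriv (wp om1 om2) z) ^ 2 =
      4 * wp om1 om2 z ^ 3 - g2 om1 om2 * wp om1 om2 z - g3 om1 om2 := by
  let L : PeriodPair := ⟨om1, om2, h⟩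
  have hg2 : g2 om1 om2 = L.g₂ := by
    unfold g2 PeriodPair.g₂ PeriodPair.G
    rw [tsum_lattice_eq L (fun x => (x ^ 4)⁻¹) (by simp)]
    simp [L]
  have hg3 : g3 om1 om2 = L.g₃ := by
    unfold g3 PeriodPair.g₃ PeriodPair.G
    rw [tsum_lattice_eq L (fun x => (x ^ 6)⁻¹) (by simp)]
    simp [L]
  have hwp : wp om1 om2 = L.weierstrassP := by
    funext w
    rw [← L.weierstrassPExcept_add 0 w]
    unfold wp PeriodPair.weierstrassPExcept
    have := tsum_lattice_eq L
      (fun x => if x = 0 then 0 else (1 / (w - x) ^ 2 - 1 / x ^ 2)) (by simp)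
    simp only [ZeroMemClass.coe_zero]
    rw [this, add_comm]
    congr 1
    · refine tsum_congr fun p => ?_
      have hp : latticePt L.ω₁ L.ω₂ p.1 ≠ 0 := by
        intro h0
        apply p.2
        have := L.latticeEquiv_symm_apply p.1
        rw [show (p.1.1 : ℂ) * L.ω₁ + p.1.2 * L.ω₂ = 0 from h0] at this
        simpa using this
      rw [if_neg hp]
    · simp
  have hz' : z ∉ L.lattice := by
    intro hm
    obtain ⟨m, n, e⟩ := PeriodPair.mem_lattice.mp hm
    exact hz ⟨(m, n), e⟩
  rw [hwp, hg2, hg3, L.deriv_weierstrassP]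
  exact L.derivWeierstrassP_sq z hz'
end
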